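/- arXiv:2510.04734 — 2 statements merged into one kernel-verified Lean document; each statement's English description precedes it below -/
import Mathlib

section
/- Let N ≥ 1 and let U be an N×N complex unitary matrix. Suppose V is an N×N complex unitary matrix and φ : Fin N → ℝ satisfies −π < φ n ≤ π for all n and U = V · diagonal(fun n => Complex.exp (Complex.I * φ n)) · Vᴴ. Let X = V · diagonal(fun n => Complex.I * φ n) · Vᴴ. Let (B i)_{i ∈ Fin (N^2)} be a family of N×N complex matrices that is orthonormal with respect to the real inner product ⟨A, B⟩ = Re (trace (Aᴴ · B)), i.e. Re (trace ((B i)ᴴ · B j)) equals 1 if i = j and 0 otherwise. Then for every i ∈ Fin (N^2), the coordinate α i = Re (trace ((B i)ᴴ · X)) satisfies |α i| ≤ Real.sqrt N * π. -/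
open Matrix

open scoped ComplexOrder in
theorem re_trace_conjTranspose_mul_self_nonneg {n : Type*} [Fintype n] (A : Matrix n n ℂ) :
    0 ≤ (Matrix.trace (Aᴴ * A)).re :=
  (Complex.nonneg_iff.mp (posSemidef_conjTranspose_mul_self A).trace_nonneg).1

theorem re_trace_conjTranspose_mul_comm {n : Type*} [Fintype n] (A B : Matrix n n ℂ) :
    (Matrix.trace (Aᴴ * B)).re = (Matrix.trace (Bᴴ * A)).re := by
  rw [← conjTranspose_conjTranspose B, ← conjTranspose_mul, trace_conjTranspose]
  simp

/-- Cauchy–Schwarz for the real Hilbert–Schmidt inner product against a unit vector. -/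
theorem sq_re_trace_conjTranspose_mul_le {n : Type*} [Fintype n] (A X : Matrix n n ℂ)
    (hA : (Matrix.trace (Aᴴ * A)).re = 1) :
    (Matrix.trace (Aᴴ * X)).re ^ 2 ≤ (Matrix.trace (Xᴴ * X)).re := by
  set t : ℝ := (Matrix.trace (Aᴴ * X)).re with ht
  have h := re_trace_conjTranspose_mul_self_nonneg (X - (t : ℂ) • A)
  have hsymm := re_trace_conjTranspose_mul_comm X A
  simp only [conjTranspose_sub, conjTranspose_smul, sub_mul, mul_sub, Matrix.smul_mul,
    Matrix.mul_smul, trace_sub, trace_smul, Complex.sub_re, smul_eq_mul, Complex.star_def,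
    Complex.conj_ofReal, Complex.re_ofReal_mul, hA, hsymm, ← ht] at h
  linarith

/-- Unitary conjugation preserves the squared Hilbert–Schmidt norm of an imaginary diagonal. -/
theorem re_trace_conjTranspose_mul_self_conj_diagonal {n : Type*} [Fintype n] [DecidableEq n]
    (V : Matrix n n ℂ) (hV : Vᴴ * V = 1) (φ : n → ℝ) :
    (Matrix.trace ((V * Matrix.diagonal (fun k => Complex.I * (φ k : ℂ)) * Vᴴ)ᴴ *
      (V * Matrix.diagonal (fun k => Complex.I * (φ k : ℂ)) * Vᴴ))).re = ∑ k, φ k ^ 2 := by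
  set D := Matrix.diagonal (fun k => Complex.I * (φ k : ℂ)) with hD
  have h : (V * D * Vᴴ)ᴴ * (V * D * Vᴴ) = V * (Dᴴ * D) * Vᴴ := by
    calc (V * D * Vᴴ)ᴴ * (V * D * Vᴴ) = V * Dᴴ * (Vᴴ * V) * D * Vᴴ := by
          simp [conjTranspose_mul, Matrix.mul_assoc]
      _ = V * (Dᴴ * D) * Vᴴ := by simp [hV, Matrix.mul_assoc]
  rw [h, trace_mul_comm, ← Matrix.mul_assoc, hV, Matrix.one_mul, hD, diagonal_conjTranspose,
    diagonal_mul_diagonal, trace_diagonal, Complex.re_sum]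
  refine Finset.sum_congr rfl fun k _ => ?_
  simp [sq]

/-- Proposition 2 of the paper: every coordinate of the principal matrix logarithm of a
unitary matrix in an orthonormal (w.r.t. the real Hilbert–Schmidt inner product) family
is bounded in absolute value by `√N · π`. -/
theorem unitary_DEP_bounded {N : ℕ} (hN : 1 ≤ N)
    (U V : Matrix (Fin N) (Fin N) ℂ)
    (hU1 : Uᴴ * U = 1) (hU2 : U * Uᴴ = 1)
    (hV1 : Vᴴ * V = 1) (hV2 : V * Vᴴ = 1)
    (φ : Fin N → ℝ)
    (hφ : ∀ n, -Real.pi < φ n ∧ φ n ≤ Real.pi)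
    (hUdec : U = V * Matrix.diagonal (fun n => Complex.exp (Complex.I * (φ n : ℂ))) * Vᴴ)
    (B : Fin (N ^ 2) → Matrix (Fin N) (Fin N) ℂ)
    (hB : ∀ i j, (Matrix.trace ((B i)ᴴ * B j)).re = if i = j then 1 else 0) :
    ∀ i : Fin (N ^ 2),
      |(Matrix.trace ((B i)ᴴ *
          (V * Matrix.diagonal (fun n => Complex.I * (φ n : ℂ)) * Vᴴ))).re|
        ≤ Real.sqrt N * Real.pi := by
  intro i
  have hle := sq_re_trace_conjTranspose_mul_le (B i)
    (V * Matrix.diagonal (fun n => Complex.I * (φ n : ℂ)) * Vᴴ) (by simpa using hB i i)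
  rw [re_trace_conjTranspose_mul_self_conj_diagonal V hV1 φ] at hle
  have hsum : ∑ n, φ n ^ 2 ≤ N * Real.pi ^ 2 := by
    calc ∑ n, φ n ^ 2 ≤ ∑ _n : Fin N, Real.pi ^ 2 :=
          Finset.sum_le_sum fun n _ => sq_le_sq' (hφ n).1.le (hφ n).2
      _ = N * Real.pi ^ 2 := by simp
  refine abs_le_of_sq_le_sq ?_ (by positivity)
  rw [mul_pow, Real.sq_sqrt (Nat.cast_nonneg N)]
  exact hle.trans hsum
end

section
/- Let N ≥ 1 and let U be an N×N complex unitary matrix. Suppose V₁, V₂ are N×N complex unitary matrices and φ₁, φ₂ : Fin N → ℝ satisfy −π < φₖ n ≤ π for all n (k = 1, 2), and that U = V₁ · diagonal(fun n => Complex.exp (Complex.I * φ₁ n)) · V₁ᴴ = V₂ · diagonal(fun n => Complex.exp (Complex.I * φ₂ n)) · V₂ᴴ. Then V₁ · diagonal(fun n => Complex.I * φ₁ n) · V₁ᴴ = V₂ · diagonal(fun n => Complex.I * φ₂ n) · V₂ᴴ. -/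
open Matrix

/-- If a diagonal matrix `diagonal a` is intertwined with `diagonal b`, then so are the diagonal
matrices obtained by applying a function to the diagonal entries. -/
theorem Matrix.mul_diagonal_comp_eq_of_mul_diagonal_eq {m n R : Type*} [Fintype m] [Fintype n]
    [DecidableEq m] [DecidableEq n] [CommRing R] [IsDomain R] {W : Matrix m n R}
    {a : n → R} {b : m → R} (h : W * diagonal a = diagonal b * W) (f : R → R) :
    W * diagonal (f ∘ a) = diagonal (f ∘ b) * W := by
  ext i j
  have hij := congrFun (congrFun h i) j
  rw [mul_diagonal, diagonal_mul, mul_comm, mul_eq_mul_right_iff] at hij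
  rw [mul_diagonal, diagonal_mul]
  rcases hij with hij | hij
  · simp [hij, mul_comm]
  · simp [hij]

/-- Applying a function to the eigenvalues in a diagonalization gives a matrix that does not
depend on the diagonalization. -/
theorem Matrix.conj_diagonal_comp_eq_of_conj_diagonal_eq {n R : Type*} [Fintype n]
    [DecidableEq n] [CommRing R] [IsDomain R] {A A' B B' : Matrix n n R}
    (hA : A' * A = 1) (hB : B' * B = 1) {a b : n → R}
    (h : A * diagonal a * A' = B * diagonal b * B') (f : R → R) :
    A * diagonal (f ∘ a) * A' = B * diagonal (f ∘ b) * B' := by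
  have hA' : A * A' = 1 := mul_eq_one_comm.mp hA
  have hB' : B * B' = 1 := mul_eq_one_comm.mp hB
  have hW : (B' * A) * diagonal a = diagonal b * (B' * A) :=
    calc (B' * A) * diagonal a = B' * (A * diagonal a * A') * A := by
          simp only [Matrix.mul_assoc, hA, Matrix.mul_one]
      _ = (B' * B) * diagonal b * (B' * A) := by rw [h]; simp only [Matrix.mul_assoc]
      _ = diagonal b * (B' * A) := by rw [hB, Matrix.one_mul]
  calc A * diagonal (f ∘ a) * A' = (B * B') * A * diagonal (f ∘ a) * A' := by
        rw [hB', Matrix.one_mul]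
    _ = B * ((B' * A) * diagonal (f ∘ a)) * A' := by simp only [Matrix.mul_assoc]
    _ = B * diagonal (f ∘ b) * B' := by
        rw [mul_diagonal_comp_eq_of_mul_diagonal_eq hW]
        simp only [Matrix.mul_assoc, hA', Matrix.mul_one]

theorem Complex.log_exp_I_mul_ofReal {x : ℝ} (hx : -Real.pi < x ∧ x ≤ Real.pi) :
    Complex.log (Complex.exp (Complex.I * (x : ℂ))) = Complex.I * (x : ℂ) :=
  Complex.log_exp (by simpa using hx.1) (by simpa using hx.2)

/-- The principal matrix logarithm of a unitary matrix is well defined: it does not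
depend on the chosen phase-normalized spectral decomposition. -/
theorem principal_log_well_defined {N : ℕ} (hN : 1 ≤ N)
    (U V₁ V₂ : Matrix (Fin N) (Fin N) ℂ)
    (hU1 : Uᴴ * U = 1) (hU2 : U * Uᴴ = 1)
    (hV₁1 : V₁ᴴ * V₁ = 1) (hV₁2 : V₁ * V₁ᴴ = 1)
    (hV₂1 : V₂ᴴ * V₂ = 1) (hV₂2 : V₂ * V₂ᴴ = 1)
    (φ₁ φ₂ : Fin N → ℝ)
    (hφ₁ : ∀ n, -Real.pi < φ₁ n ∧ φ₁ n ≤ Real.pi)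
    (hφ₂ : ∀ n, -Real.pi < φ₂ n ∧ φ₂ n ≤ Real.pi)
    (hU₁ : U = V₁ * Matrix.diagonal (fun n => Complex.exp (Complex.I * (φ₁ n : ℂ))) * V₁ᴴ)
    (hU₂ : U = V₂ * Matrix.diagonal (fun n => Complex.exp (Complex.I * (φ₂ n : ℂ))) * V₂ᴴ) :
    V₁ * Matrix.diagonal (fun n => Complex.I * (φ₁ n : ℂ)) * V₁ᴴ
      = V₂ * Matrix.diagonal (fun n => Complex.I * (φ₂ n : ℂ)) * V₂ᴴ := by
  simpa only [Function.comp_def, Complex.log_exp_I_mul_ofReal (hφ₁ _),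
    Complex.log_exp_I_mul_ofReal (hφ₂ _)] using
    conj_diagonal_comp_eq_of_conj_diagonal_eq hV₁1 hV₂1 (hU₁.symm.trans hU₂) Complex.log
end
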